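/- Assume α ∈ (0,2], the Hurst functional index H satisfies (H₁) and (H₂), let d ≥ 1 be an integer, let I := [ε,T]^N with 0 < ε < T, and assume d < inf_{v∈I} ∑_{l=1}^N 1/h_l(v). For an integer n ≥ 1 and a cube I_{a,δ} = ∏_{l=1}^N [a_l, a_l + δ] ⊆ I define M_n(I_{a,δ}) := (2π)^{−nd} · ∫_{(I_{a,δ})^n} ( ∫_{ℝ^n} exp(−∫_{ℝ^N} |∑_{j=1}^n x_j · g^{H(u^j)}(u^j, w)|^α dw) dx )^d du^1 … du^n. Then for every integer n ≥ 1 there exist constants c(n) > 0 and δ₀(n) ∈ (0,1] such that for every cube I_{a,δ} ⊆ I with δ ∈ (0, δ₀(n)]: M_n(I_{a,δ}) ≤ c(n) · δ^{n·β̄}, where β̄ := sup_{v ∈ I_{a,δ}, σ ∈ S(N)} β_σ(v). -/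

import Mathlib

open MeasureTheory Finset
open scoped ENNReal

/-- `(a₊)^c` with the convention `0^c := 0` for every real exponent `c`. -/
noncomputable def ppow (a c : ℝ) : ℝ := if 0 < a then a ^ c else 0

/-- The multifractional kernel `g^{H(u)}(u,w)`. -/
noncomputable def kernelG (N : ℕ) (α : ℝ) (h : Fin N → (Fin N → ℝ) → ℝ)
    (u w : Fin N → ℝ) : ℝ :=
  ∏ l, (ppow (u l - w l) (h l u - 1 / α) - ppow (-w l) (h l u - 1 / α))

/-- The moment quantity
`M_n(C) = (2π)^{-nd} ∫_{C^n} (∫_{ℝ^n} exp(-∫_{ℝ^N} |∑_j x_j g^{H(u^j)}(u^j,w)|^α dw) dx)^d du`. -/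
noncomputable def Mn (N d : ℕ) (α : ℝ) (h : Fin N → (Fin N → ℝ) → ℝ)
    (n : ℕ) (C : Set (Fin N → ℝ)) : ℝ≥0∞ :=
  ENNReal.ofReal ((2 * Real.pi) ^ (-((n : ℝ) * d))) *
    ∫⁻ U : Fin n → Fin N → ℝ in {U | ∀ j, U j ∈ C},
      (∫⁻ x : Fin n → ℝ,
        ENNReal.ofReal (Real.exp (-(∫ w : Fin N → ℝ,
          |∑ j, x j * kernelG N α h (U j) w| ^ α)))) ^ d

/-- `γ_σ(v) = min{m : d < ∑_{l=1}^m 1/h_{σ(l)}(v)}` (a natural number). -/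
noncomputable def gammaIdx (N d : ℕ) (h : Fin N → (Fin N → ℝ) → ℝ)
    (σ : Equiv.Perm (Fin N)) (v : Fin N → ℝ) : ℕ :=
  sInf {mm : ℕ |
    (d : ℝ) < ∑ l ∈ Finset.univ.filter (fun l : Fin N => (l : ℕ) < mm), 1 / h (σ l) v}

/-- `β_σ(v) = N - γ_σ(v) + h_{σ(γ_σ(v))}(v)(∑_{l=1}^{γ_σ(v)} 1/h_{σ(l)}(v) - d)`. -/
noncomputable def betaFn (N d : ℕ) (h : Fin N → (Fin N → ℝ) → ℝ)
    (σ : Equiv.Perm (Fin N)) (v : Fin N → ℝ) : ℝ :=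
  if hγ : gammaIdx N d h σ v - 1 < N then
    (N : ℝ) - gammaIdx N d h σ v +
      h (σ ⟨gammaIdx N d h σ v - 1, hγ⟩) v *
        ((∑ l ∈ Finset.univ.filter (fun l : Fin N => (l : ℕ) < gammaIdx N d h σ v),
            1 / h (σ l) v) - d)
  else 0

theorem lintegral_prod_le_of_triangular {E : Type*} [MeasureSpace E]
    [SigmaFinite (volume : Measure E)] [Nonempty E] :
    ∀ (n : ℕ) (f : Fin n → (Fin n → E) → ℝ≥0∞) (C : Fin n → ℝ≥0∞),
      (∀ j, Measurable (f j)) →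
      (∀ j x y, (∀ i, j ≤ i → x i = y i) → f j x = f j y) →
      (∀ j x, ∫⁻ t, f j (Function.update x j t) ≤ C j) →
      ∫⁻ x, ∏ j, f j x ≤ ∏ j, C j := by
  intro n
  induction n with
  | zero =>
    intro f C _ _ _
    simp [lintegral_unique, volume_pi]
  | succ n ih =>
    intro f C hmeas hdep hbd
    obtain ⟨e⟩ := ‹Nonempty E›
    have hcons : Measurable fun z : E × (Fin n → E) => (Fin.cons z.1 z.2 : Fin (n + 1) → E) := by
      refine measurable_pi_iff.2 fun i => ?_
      refine Fin.cases ?_ (fun i => ?_) i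
      · simpa using measurable_fst
      · simp only [Fin.cons_succ]; fun_prop
    have h0 : ∀ x' : Fin n → E, ∫⁻ t, f 0 (Fin.cons t x') ≤ C 0 := fun x' => by
      simpa [Fin.update_cons_zero] using hbd 0 (Fin.cons e x')
    have hsucc : ∀ (j : Fin n) t (x' : Fin n → E),
        f j.succ (Fin.cons t x') = f j.succ (Fin.cons e x') := fun j t x' => by
      refine hdep _ _ _ fun i hi => ?_
      obtain ⟨i, rfl⟩ := Fin.exists_succ_eq_of_ne_zero (x := i) (by rintro rfl; simp at hi)
      simp
    have hcons' : Measurable fun x' : Fin n → E => (Fin.cons e x' : Fin (n + 1) → E) :=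
      hcons.comp (measurable_const.prodMk measurable_id)
    have ih' := ih (fun j x' => f j.succ (Fin.cons e x')) (fun j => C j.succ)
      (fun j => (hmeas _).comp hcons')
      (fun j x y hxy => hdep _ _ _ fun i hi => by
        refine Fin.cases (by simp) (fun i hi => ?_) i hi
        simpa using hxy i (by simpa using hi))
      (fun j x' => by
        have := hbd j.succ (Fin.cons e x')
        simpa [Fin.cons_update] using this)
    have hmp := (volume_preserving_piFinSuccAbove (fun _ : Fin (n + 1) => E) 0).symm
    rw [← hmp.lintegral_comp_emb (MeasurableEquiv.measurableEmbedding _)]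
    have heq : ∀ z : E × (Fin n → E),
        (MeasurableEquiv.piFinSuccAbove (fun _ : Fin (n + 1) => E) 0).symm z
          = Fin.cons z.1 z.2 := fun z => by
      simp [MeasurableEquiv.piFinSuccAbove, Fin.insertNthEquiv]
    simp_rw [heq]
    rw [Measure.volume_eq_prod, lintegral_prod_symm' _ (by
      exact Finset.measurable_prod _ fun j _ => (hmeas j).comp hcons)]
    simp_rw [Fin.prod_univ_succ, hsucc]
    calc ∫⁻ x' : Fin n → E, ∫⁻ t, f 0 (Fin.cons t x') * ∏ j : Fin n, f j.succ (Fin.cons e x')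
        = ∫⁻ x' : Fin n → E, (∫⁻ t, f 0 (Fin.cons t x')) *
            ∏ j : Fin n, f j.succ (Fin.cons e x') := by
          refine lintegral_congr fun x' => ?_
          rw [lintegral_mul_const]
          exact (hmeas 0).comp (hcons.comp (measurable_id.prodMk measurable_const))
      _ ≤ ∫⁻ x' : Fin n → E, C 0 * ∏ j : Fin n, f j.succ (Fin.cons e x') := by
          gcongr with x'; exact h0 x'
      _ = C 0 * ∫⁻ x' : Fin n → E, ∏ j : Fin n, f j.succ (Fin.cons e x') := by
          rw [lintegral_const_mul]
          exact Finset.measurable_prod _ fun j _ => (hmeas _).comp hcons'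
      _ ≤ _ := by gcongr

/-- Fubini for functions of the columns of a matrix. -/
theorem lintegral_prod_col_le (n N : ℕ) (Φ : Fin N → (Fin n → ℝ) → ℝ≥0∞)
    (hΦ : ∀ l, Measurable (Φ l)) :
    ∫⁻ U : Fin n → Fin N → ℝ, ∏ l, Φ l (fun j => U j l) ≤ ∏ l, ∫⁻ t, Φ l t := by
  have h1 : MeasurePreserving (fun (U : Fin n → Fin N → ℝ) (p : Fin n × Fin N) => U p.1 p.2) := by
    refine ⟨by fun_prop, (Measure.pi_eq fun s hs => ?_).symm⟩
    rw [Measure.map_apply (by fun_prop) (MeasurableSet.univ_pi hs)]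
    have : (fun (U : Fin n → Fin N → ℝ) (p : Fin n × Fin N) => U p.1 p.2) ⁻¹' Set.univ.pi s
        = Set.univ.pi fun i => Set.univ.pi fun k => s (i, k) := by
      ext U; simp [Set.mem_pi, Prod.forall]
    rw [this, volume_pi_pi]
    simp_rw [volume_pi_pi]
    rw [Fintype.prod_prod_type]
  have h2 : MeasurePreserving (fun (V : Fin N → Fin n → ℝ) (p : Fin n × Fin N) => V p.2 p.1) := by
    refine ⟨by fun_prop, (Measure.pi_eq fun s hs => ?_).symm⟩
    rw [Measure.map_apply (by fun_prop) (MeasurableSet.univ_pi hs)]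
    have : (fun (V : Fin N → Fin n → ℝ) (p : Fin n × Fin N) => V p.2 p.1) ⁻¹' Set.univ.pi s
        = Set.univ.pi fun k => Set.univ.pi fun i => s (i, k) := by
      ext U; simp only [Set.mem_preimage, Set.mem_pi, Prod.forall]; simp; exact forall_comm
    rw [this, volume_pi_pi]
    simp_rw [volume_pi_pi]
    rw [Fintype.prod_prod_type_right]
  have hm : Measurable fun P : Fin n × Fin N → ℝ => ∏ l, Φ l fun j => P (j, l) :=
    Finset.measurable_prod _ fun l _ => (hΦ l).comp (by fun_prop)
  rw [show ∫⁻ U : Fin n → Fin N → ℝ, ∏ l, Φ l (fun j => U j l) =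
      ∫⁻ P : Fin n × Fin N → ℝ, ∏ l, Φ l fun j => P (j, l) from h1.lintegral_comp hm,
    ← h2.lintegral_comp hm]
  refine lintegral_prod_le_of_triangular N (fun l V => Φ l (V l)) _
    (fun l => (hΦ l).comp (measurable_pi_apply l)) (fun j x y hxy => by simp [hxy j le_rfl])
    (fun j x => by simp)

/-- The total mass of `t ↦ exp (-|t|^α)`. -/
noncomputable def expMass (α : ℝ) : ℝ≥0∞ :=
  ∫⁻ t : ℝ, ENNReal.ofReal (Real.exp (-|t| ^ α))

theorem expMass_ne_top {α : ℝ} (hα : 0 < α) : expMass α ≠ ⊤ := by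
  refine (Integrable.lintegral_lt_top (Integrable.of_integral_ne_zero ?_)).ne
  rw [integral_comp_abs (f := fun t => Real.exp (-t ^ α)), integral_exp_neg_rpow hα]
  have := Real.Gamma_pos_of_pos (show 0 < 1 / α + 1 by positivity)
  positivity

theorem lintegral_exp_neg_mul_rpow_abs {α b : ℝ} (hα : 0 < α) (hb : 0 < b) (x₀ : ℝ) :
    ∫⁻ x : ℝ, ENNReal.ofReal (Real.exp (-(b * |x - x₀| ^ α)))
      = ENNReal.ofReal b ^ (-1 / α) * expMass α := by
  rw [lintegral_sub_right_eq_self (fun x => ENNReal.ofReal (Real.exp (-(b * |x| ^ α)))) x₀]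
  have hc : 0 < b ^ (1 / α) := by positivity
  have hmap := Real.map_volume_mul_left hc.ne'
  have hm : Measurable fun t : ℝ => ENNReal.ofReal (Real.exp (-|t| ^ α)) := by fun_prop
  have h1 : ∫⁻ x : ℝ, ENNReal.ofReal (Real.exp (-(b * |x| ^ α)))
      = ∫⁻ x : ℝ, ENNReal.ofReal (Real.exp (-|b ^ (1 / α) * x| ^ α)) := by
    refine lintegral_congr fun x => ?_
    rw [abs_mul, abs_of_pos hc, Real.mul_rpow hc.le (abs_nonneg _), ← Real.rpow_mul hb.le,
      one_div_mul_cancel hα.ne', Real.rpow_one]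
  rw [h1, ← lintegral_map hm (measurable_const_mul _), hmap, lintegral_smul_measure, expMass,
    smul_eq_mul, abs_of_pos (by positivity), ENNReal.ofReal_rpow_of_pos hb, ← Real.rpow_neg hb.le,
    neg_div]

theorem abs_sub_rpow_le {α : ℝ} (hα : 0 < α) (hα2 : α ≤ 2) (a b : ℝ) :
    |a - b| ^ α ≤ 4 * (|a| ^ α + |b| ^ α) := by
  have h1 : |a - b| ≤ 2 * max |a| |b| := by
    have := abs_sub a b
    have := le_max_left |a| |b|
    have := le_max_right |a| |b|
    linarith
  have h2 : (max |a| |b|) ^ α ≤ |a| ^ α + |b| ^ α := by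
    have := Real.rpow_nonneg (abs_nonneg a) α
    have := Real.rpow_nonneg (abs_nonneg b) α
    rcases max_choice |a| |b| with h | h <;> rw [h] <;> linarith
  calc |a - b| ^ α ≤ (2 * max |a| |b|) ^ α := by gcongr
    _ = 2 ^ α * (max |a| |b|) ^ α := Real.mul_rpow (by norm_num) (by positivity)
    _ ≤ 2 ^ (2 : ℝ) * (|a| ^ α + |b| ^ α) := by
        gcongr
        norm_num
    _ = _ := by norm_num

/-- The constant in the one-dimensional bound for the integral of `exp (-‖x g + r‖_α^α)`. -/
noncomputable def shiftConst (α : ℝ) : ℝ≥0∞ :=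
  ENNReal.ofReal (Real.exp 1) * (ENNReal.ofReal (1 / 8) ^ (-1 / α) * expMass α)

theorem shiftConst_ne_top {α : ℝ} (hα : 0 < α) : shiftConst α ≠ ⊤ := by
  refine ENNReal.mul_ne_top ENNReal.ofReal_ne_top (ENNReal.mul_ne_top ?_ (expMass_ne_top hα))
  rw [ENNReal.ofReal_rpow_of_pos (by norm_num)]
  exact ENNReal.ofReal_ne_top

theorem lintegral_exp_neg_integral_le {X : Type*} [MeasurableSpace X] {μ : Measure X} {α : ℝ}
    (hα : 0 < α) (hα2 : α ≤ 2) (g r : X → ℝ) (hg : Integrable (fun w => |g w| ^ α) μ)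
    (hgr : ∀ x : ℝ, Integrable (fun w => |x * g w + r w| ^ α) μ) :
    ∫⁻ x : ℝ, ENNReal.ofReal (Real.exp (-∫ w, |x * g w + r w| ^ α ∂μ))
      ≤ shiftConst α * ENNReal.ofReal (∫ w, |g w| ^ α ∂μ) ^ (-1 / α) := by
  have hG0 : 0 ≤ ∫ w, |g w| ^ α ∂μ := integral_nonneg fun w => by positivity
  set G := ∫ w, |g w| ^ α ∂μ with hG
  set F : ℝ → ℝ := fun x => ∫ w, |x * g w + r w| ^ α ∂μ with hF
  have hF0 : ∀ x, 0 ≤ F x := fun x => integral_nonneg fun w => by positivity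
  rcases hG0.eq_or_lt with h0 | hGpos
  · have hneg : -1 / α < 0 := by rw [neg_div]; simp [hα]
    rw [← h0, ENNReal.ofReal_zero, ENNReal.zero_rpow_of_neg hneg, ENNReal.mul_top]
    · exact le_top
    · have : expMass α ≠ 0 := by
        have := lintegral_exp_neg_mul_rpow_abs hα one_pos 0
        rw [expMass, Ne, lintegral_eq_zero_iff (by fun_prop)]
        intro h
        have := h.exists
        obtain ⟨t, ht⟩ := this
        simp at ht
        linarith [Real.exp_pos (-|t| ^ α)]
      refine mul_ne_zero (by simp [Real.exp_pos]) (mul_ne_zero ?_ this)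
      rw [ENNReal.ofReal_rpow_of_pos (by norm_num)]
      simp only [ne_eq, ENNReal.ofReal_eq_zero, not_le]
      positivity
  · have hdiff : ∀ x y, |x - y| ^ α * G ≤ 4 * (F x + F y) := fun x y => by
      rw [hG, hF, ← integral_const_mul]
      simp only
      rw [← integral_add (hgr x) (hgr y), ← integral_const_mul]
      refine integral_mono (hg.const_mul _) (((hgr x).add (hgr y)).const_mul _) fun w => ?_
      simp only
      rw [← Real.mul_rpow (abs_nonneg _) (abs_nonneg _), ← abs_mul]
      refine le_of_eq_of_le ?_ (abs_sub_rpow_le hα hα2 _ _)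
      congr 2; ring
    obtain ⟨x₀, hx₀⟩ : ∃ x₀, ∀ x, F x₀ ≤ F x + 1 := by
      have hbdd : BddBelow (Set.range F) := ⟨0, by rintro _ ⟨x, rfl⟩; exact hF0 x⟩
      obtain ⟨x₀, hx₀⟩ := exists_lt_of_ciInf_lt (lt_add_one (⨅ x, F x))
      exact ⟨x₀, fun x => hx₀.le.trans (by linarith [ciInf_le hbdd x])⟩
    calc ∫⁻ x : ℝ, ENNReal.ofReal (Real.exp (-F x))
        ≤ ∫⁻ x : ℝ, ENNReal.ofReal (Real.exp 1) *
            ENNReal.ofReal (Real.exp (-((1 / 8 * G) * |x - x₀| ^ α))) := by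
          refine lintegral_mono fun x => ?_
          rw [← ENNReal.ofReal_mul (Real.exp_pos _).le, ← Real.exp_add]
          refine ENNReal.ofReal_le_ofReal (Real.exp_le_exp.2 ?_)
          nlinarith [hdiff x x₀, hx₀ x]
      _ = _ := by
          rw [lintegral_const_mul _ (by fun_prop),
            lintegral_exp_neg_mul_rpow_abs hα (by positivity), shiftConst,
            ENNReal.ofReal_mul (by norm_num), ENNReal.mul_rpow_of_ne_zero (by simp) (by simpa)]
          ring

theorem integral_abs_sum_rpow_ge {X : Type*} [MeasurableSpace X] {μ : Measure X} {α : ℝ}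
    {n : ℕ} (f : X → ℝ) (hf : Integrable (fun w => |f w| ^ α) μ) (A : Fin n → Set X)
    (hA : ∀ j, MeasurableSet (A j)) (hdisj : Pairwise (Function.onFun Disjoint A)) :
    ∑ j, ∫ w in A j, |f w| ^ α ∂μ ≤ ∫ w, |f w| ^ α ∂μ := by
  rw [← integral_iUnion_fintype hA hdisj fun j => hf.integrableOn]
  exact setIntegral_le_integral hf (ae_of_all _ fun w => by positivity)

theorem MeasureTheory.MemLp.integrable_abs_rpow {X : Type*} [MeasurableSpace X] {μ : Measure X}
    {α : ℝ} (hα : 0 < α) {f : X → ℝ} (hf : MemLp f (ENNReal.ofReal α) μ) :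
    Integrable (fun w => |f w| ^ α) μ := by
  have := hf.integrable_norm_rpow (by simpa) ENNReal.ofReal_ne_top
  simpa [ENNReal.toReal_ofReal hα.le] using this

/-- Successively integrating out the coefficients of a combination of functions which is
triangular with respect to a family of disjoint sets. -/
theorem lintegral_exp_neg_integral_sum_le {X : Type*} [MeasurableSpace X] {μ : Measure X}
    [SFinite μ] {α : ℝ} (hα : 0 < α) (hα2 : α ≤ 2) {n : ℕ} (g : Fin n → X → ℝ)
    (hgm : ∀ j, Measurable (g j)) (hg : ∀ j, MemLp (g j) (ENNReal.ofReal α) μ)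
    (A : Fin n → Set X) (hA : ∀ j, MeasurableSet (A j))
    (hdisj : Pairwise (Function.onFun Disjoint A))
    (hzero : ∀ i j, i < j → ∀ w ∈ A j, g i w = 0) :
    ∫⁻ x : Fin n → ℝ, ENNReal.ofReal (Real.exp (-∫ w, |∑ j, x j * g j w| ^ α ∂μ))
      ≤ ∏ j, (shiftConst α * ENNReal.ofReal (∫ w in A j, |g j w| ^ α ∂μ) ^ (-1 / α)) := by
  have hmem : ∀ x : Fin n → ℝ, MemLp (fun w => ∑ j, x j * g j w) (ENNReal.ofReal α) μ :=
    fun x => memLp_finsetSum _ fun j _ => (hg j).const_mul (x j)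
  set f : Fin n → (Fin n → ℝ) → ℝ≥0∞ := fun j x =>
    ENNReal.ofReal (Real.exp (-∫ w in A j, |∑ i, x i * g i w| ^ α ∂μ)) with hf
  calc _ ≤ ∫⁻ x : Fin n → ℝ, ∏ j, f j x := by
        refine lintegral_mono fun x => ?_
        rw [hf]
        simp only
        rw [← ENNReal.ofReal_prod_of_nonneg fun j _ => (Real.exp_pos _).le, ← Real.exp_sum]
        refine ENNReal.ofReal_le_ofReal (Real.exp_le_exp.2 ?_)
        rw [Finset.sum_neg_distrib]
        exact neg_le_neg (integral_abs_sum_rpow_ge _ ((hmem x).integrable_abs_rpow hα) A hA hdisj)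
    _ ≤ _ := by
        refine lintegral_prod_le_of_triangular n f _ (fun j => ?_) (fun j x y hxy => ?_)
          fun j x => ?_
        · refine ENNReal.measurable_ofReal.comp (Real.measurable_exp.comp (Measurable.neg ?_))
          refine (StronglyMeasurable.integral_prod_right ?_).measurable
          refine Measurable.stronglyMeasurable ?_
          refine Measurable.pow_const (Measurable.abs ?_) _
          refine Finset.measurable_sum _ fun i _ => ?_
          exact ((measurable_pi_apply i).comp measurable_fst).mul ((hgm i).comp measurable_snd)
        · simp only [hf]
          congr 3
          refine setIntegral_congr_fun (hA j) fun w hw => ?_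
          congr 2
          refine Finset.sum_congr rfl fun i _ => ?_
          rcases lt_or_ge i j with h | h
          · simp [hzero i j h w hw]
          · rw [hxy i h]
        · have key : ∀ t w, ∑ i, Function.update x j t i * g i w
              = t * g j w + ∑ i ∈ Finset.univ.erase j, x i * g i w := fun t w => by
            rw [← Finset.add_sum_erase _ _ (Finset.mem_univ j)]
            congr 1
            · simp
            · refine Finset.sum_congr rfl fun i hi => ?_
              rw [Function.update_of_ne (Finset.ne_of_mem_erase hi)]
          simp only [hf]
          simp_rw [key]
          refine lintegral_exp_neg_integral_le hα hα2 (g j) _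
            ((hg j).integrable_abs_rpow hα).integrableOn fun t => ?_
          have := ((hmem (Function.update x j t)).integrable_abs_rpow hα).integrableOn (s := A j)
          simp_rw [key] at this
          exact this

theorem measurable_ppow (c : ℝ) : Measurable fun a => ppow a c := by
  unfold ppow
  exact Measurable.ite measurableSet_Ioi (by fun_prop) measurable_const

theorem measurable_kernelG (N : ℕ) (α : ℝ) (h : Fin N → (Fin N → ℝ) → ℝ) (u : Fin N → ℝ) :
    Measurable (kernelG N α h u) := by
  unfold kernelG
  refine Finset.measurable_prod _ fun l _ => Measurable.sub ?_ ?_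
  · exact (measurable_ppow _).comp (by fun_prop)
  · exact (measurable_ppow _).comp (by fun_prop)

theorem integrableOn_ppow_rpow {α κ : ℝ} (hκ : -1 < κ * α) (hα : 0 < α) (a b c : ℝ) :
    IntegrableOn (fun w => |ppow (a - w) κ| ^ α) (Set.Ioc b c) := by
  rcases le_total b c with hbc | hbc
  · have h1 : IntervalIntegrable (fun w : ℝ => (a - w) ^ (κ * α)) volume b c := by
      have := (intervalIntegral.intervalIntegrable_rpow' hκ
        (a := a - b) (b := a - c)).comp_sub_left a
      simpa using this
    rw [intervalIntegrable_iff_integrableOn_Ioc_of_le hbc] at h1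
    refine Integrable.mono h1 ?_ (ae_of_all _ fun w => ?_)
    · exact ((measurable_ppow κ).comp (measurable_const.sub measurable_id)).abs.pow_const _
        |>.aestronglyMeasurable
    · unfold ppow
      split_ifs with h
      · rw [abs_of_pos (by positivity), ← Real.rpow_mul h.le]
      · simp [Real.zero_rpow hα.ne']
  · simp [Set.Ioc_eq_empty_of_le hbc]

theorem abs_rpow_sub_rpow_le {κ u s : ℝ} (hκ : κ ≤ 1) (hu : 0 < u) (hs : 0 < s) :
    |(u + s) ^ κ - s ^ κ| ≤ |κ| * u * s ^ (κ - 1) := by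
  have := Convex.norm_image_sub_le_of_norm_hasDerivWithin_le (f := fun x : ℝ => x ^ κ)
    (f' := fun x => κ * x ^ (κ - 1)) (C := |κ| * s ^ (κ - 1)) (s := Set.Icc s (u + s))
    (x := s) (y := u + s)
    (fun x hx => (Real.hasDerivAt_rpow_const (Or.inl (hs.trans_le hx.1).ne')).hasDerivWithinAt)
    (fun x hx => by
      rw [norm_mul, Real.norm_eq_abs, Real.norm_eq_abs,
        abs_of_pos (Real.rpow_pos_of_pos (hs.trans_le hx.1) _)]
      exact mul_le_mul_of_nonneg_left
        (Real.rpow_le_rpow_of_nonpos hs hx.1 (by linarith)) (abs_nonneg _))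
    (convex_Icc _ _) ⟨le_rfl, by linarith⟩ ⟨by linarith, le_rfl⟩
  simp only [Real.norm_eq_abs, add_sub_cancel_right, abs_of_pos hu] at this
  linarith

theorem integrable_abs_ppow_sub_ppow_rpow {α h u : ℝ} (hα : 0 < α) (hα2 : α ≤ 2) (h0 : 0 < h)
    (h1 : h < 1) (hu : 0 < u) :
    Integrable fun w : ℝ => |ppow (u - w) (h - 1 / α) - ppow (-w) (h - 1 / α)| ^ α := by
  set κ := h - 1 / α with hκ
  have hκα : κ * α = h * α - 1 := by rw [hκ]; field_simp
  have hκ1 : κ ≤ 1 := by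
    have : 0 < 1 / α := by positivity
    linarith
  have hmeas : Measurable fun w : ℝ => |ppow (u - w) κ - ppow (-w) κ| ^ α := by
    refine Measurable.pow_const (Measurable.abs (Measurable.sub ?_ ?_)) _
    · exact (measurable_ppow _).comp (by fun_prop)
    · exact (measurable_ppow _).comp (by fun_prop)
  have hfar : IntegrableOn (fun w : ℝ => |ppow (u - w) κ - ppow (-w) κ| ^ α) (Set.Iic (-u)) := by
    have hI : IntegrableOn (fun s : ℝ => (|κ| * u) ^ α * s ^ ((κ - 1) * α)) (Set.Ici u) := by
      refine Integrable.const_mul ?_ _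
      have := integrableOn_Ioi_rpow_of_lt (a := (κ - 1) * α) ?_ hu
      · exact Iff.mpr integrableOn_Ici_iff_integrableOn_Ioi this
      rw [sub_mul, hκα]; nlinarith
    have h2 : IntegrableOn (fun s : ℝ => |ppow (u + s) κ - ppow s κ| ^ α) (Set.Ici u) := by
      refine Integrable.mono' hI ?_ ?_
      · refine (Measurable.pow_const (Measurable.abs (Measurable.sub ?_ ?_)) _).aestronglyMeasurable
        · exact (measurable_ppow _).comp (by fun_prop)
        · exact measurable_ppow _
      · refine (ae_restrict_iff' measurableSet_Ici).2 (ae_of_all _ fun s hs => ?_)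
        have hs0 : 0 < s := hu.trans_le hs
        rw [Real.norm_eq_abs, abs_of_nonneg (by positivity)]
        simp only [ppow, hs0, add_pos hu hs0, if_true]
        rw [Real.rpow_mul hs0.le, ← Real.mul_rpow (by positivity) (by positivity)]
        exact Real.rpow_le_rpow (abs_nonneg _) (abs_rpow_sub_rpow_le hκ1 hu hs0) hα.le
    have := IntegrableOn.comp_neg_Iic (c := -u) (f := fun s : ℝ => |ppow (u + s) κ - ppow s κ| ^ α)
      (by simpa using h2)
    simpa [sub_eq_add_neg] using this
  have hmid : IntegrableOn (fun w : ℝ => |ppow (u - w) κ - ppow (-w) κ| ^ α) (Set.Ioc (-u) u) := by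
    have hI := ((integrableOn_ppow_rpow (κ := κ) (α := α) (by rw [hκα]; nlinarith) hα u (-u) u).add
      (integrableOn_ppow_rpow (κ := κ) (α := α) (by rw [hκα]; nlinarith) hα 0 (-u) u)).const_mul 4
    refine Integrable.mono' hI hmeas.aestronglyMeasurable (ae_of_all _ fun w => ?_)
    rw [Real.norm_eq_abs, abs_of_nonneg (by positivity)]
    simpa using abs_sub_rpow_le hα hα2 (ppow (u - w) κ) (ppow (0 - w) κ)
  have hright : IntegrableOn (fun w : ℝ => |ppow (u - w) κ - ppow (-w) κ| ^ α) (Set.Ioi u) := by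
    refine (integrableOn_zero (s := Set.Ioi u)).congr_fun (fun w hw => ?_) measurableSet_Ioi
    have hw' : u < w := hw
    simp [ppow, not_lt.2 hw'.le, not_lt.2 (hu.trans hw').le,
      Real.zero_rpow hα.ne']
  rw [← integrableOn_univ, ← Set.Iic_union_Ioi (a := u),
    ← Set.Iic_union_Ioc_eq_Iic (show -u ≤ u by linarith)]
  exact (hfar.union hmid).union hright

theorem memLp_kernelG {N : ℕ} {α : ℝ} (hα : 0 < α) (hα2 : α ≤ 2)
    {h : Fin N → (Fin N → ℝ) → ℝ} {u : Fin N → ℝ} (h0 : ∀ l, 0 < h l u) (h1 : ∀ l, h l u < 1)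
    (hu : ∀ l, 0 < u l) : MemLp (kernelG N α h u) (ENNReal.ofReal α) := by
  rw [← integrable_norm_rpow_iff (measurable_kernelG N α h u).aestronglyMeasurable
    (by simpa) ENNReal.ofReal_ne_top, ENNReal.toReal_ofReal hα.le]
  simp only [kernelG, Real.norm_eq_abs, Finset.abs_prod]
  simp_rw [← Real.finsetProd_rpow _ _ (fun i _ => abs_nonneg _)]
  exact Integrable.fintype_prod (𝕜 := ℝ)
    (f := fun l w => |ppow (u l - w) (h l u - 1 / α) - ppow (-w) (h l u - 1 / α)| ^ α)
    fun l => integrable_abs_ppow_sub_ppow_rpow hα hα2 (h0 l) (h1 l) (hu l)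

theorem le_rpow_of_mem_Icc {r e ε T : ℝ} (hε : 0 < ε) (hr : ε / 2 ≤ r) (hrT : r ≤ T) (he : -1 ≤ e)
    (he' : e ≤ 1) : min (ε / 2) (1 / T) ≤ r ^ e := by
  have hr0 : 0 < r := by linarith
  rcases le_total r 1 with h | h
  · calc _ ≤ ε / 2 := min_le_left _ _
      _ ≤ r ^ (1 : ℝ) := by simpa
      _ ≤ r ^ e := Real.rpow_le_rpow_of_exponent_ge hr0 h he'
  · calc _ ≤ 1 / T := min_le_right _ _
      _ ≤ 1 / r := one_div_le_one_div_of_le hr0 hrT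
      _ = r ^ (-1 : ℝ) := by rw [Real.rpow_neg_one, one_div]
      _ ≤ r ^ e := Real.rpow_le_rpow_of_exponent_le h he

theorem half_rpow_le {r e D : ℝ} (hD : 0 < D) (hr : D / 2 ≤ r) (hrD : r ≤ D)
    (he' : e ≤ 1) : D ^ e / 2 ≤ r ^ e := by
  have hr0 : 0 < r := by linarith
  rcases le_total 0 e with h | h
  · calc D ^ e / 2 = D ^ e / 2 ^ (1 : ℝ) := by simp
      _ ≤ D ^ e / 2 ^ e := by gcongr; norm_num
      _ = (D / 2) ^ e := (Real.div_rpow hD.le (by norm_num) _).symm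
      _ ≤ r ^ e := by gcongr
  · have := Real.rpow_le_rpow_of_nonpos hr0 hrD h
    have : 0 < D ^ e := by positivity
    linarith

/-- A box on which only the `l`-th side has variable length. -/
def sideBox (N : ℕ) (l : Fin N) (ε p q : ℝ) : Set (Fin N → ℝ) :=
  Set.univ.pi fun k => if k = l then Set.Ioo p ((p + q) / 2) else Set.Ioo 0 (ε / 2)

theorem measurableSet_sideBox (N : ℕ) (l : Fin N) (ε p q : ℝ) :
    MeasurableSet (sideBox N l ε p q) :=
  MeasurableSet.univ_pi fun k => by split_ifs <;> exact measurableSet_Ioo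

theorem mem_Ioo_of_mem_sideBox {N : ℕ} {l : Fin N} {ε p q : ℝ} {w : Fin N → ℝ}
    (hw : w ∈ sideBox N l ε p q) : w l ∈ Set.Ioo p ((p + q) / 2) := by
  simpa using hw l (Set.mem_univ l)

/-- The constant in the lower bound of the norm of the kernel on a box. -/
noncomputable def boxConst (N : ℕ) (ε T : ℝ) : ℝ :=
  1 / 4 * (min (ε / 2) (1 / T) * (ε / 2)) ^ (N - 1)

theorem prod_ite_eq_const {N : ℕ} (l : Fin N) (x y : ℝ) :
    ∏ k : Fin N, (if k = l then x else y) = x * y ^ (N - 1) := by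
  rw [Finset.prod_ite, Finset.filter_eq', Finset.filter_ne']
  simp

theorem integral_sideBox_kernelG_ge {N : ℕ} {α ε T : ℝ} (hα : 0 < α) (hα2 : α ≤ 2) (hε : 0 < ε)
    {h : Fin N → (Fin N → ℝ) → ℝ} {u : Fin N → ℝ} (h0 : ∀ l, 0 < h l u) (h1 : ∀ l, h l u < 1)
    (hu : ∀ k, ε ≤ u k) (huT : ∀ k, u k ≤ T) (l : Fin N) {p : ℝ} (hp : 0 ≤ p) (hpu : p ≤ u l) :
    boxConst N ε T * (u l - p) ^ (h l u * α)
      ≤ ∫ w in sideBox N l ε p (u l), |kernelG N α h u w| ^ α := by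
  have hlα : 0 < h l u * α := mul_pos (h0 l) hα
  rcases hpu.eq_or_lt with rfl | hlt
  · rw [sub_self, Real.zero_rpow hlα.ne', mul_zero]
    exact integral_nonneg fun w => by positivity
  set D := u l - p with hD
  have hDpos : 0 < D := sub_pos.2 hlt
  have hT : 0 < T := hε.trans_le ((hu l).trans (huT l))
  set c₀ := min (ε / 2) (1 / T) with hc₀
  have hc₀pos : 0 < c₀ := by rw [hc₀]; positivity
  set e : Fin N → ℝ := fun k => h k u * α - 1 with he
  have he1 : ∀ k, -1 ≤ e k := fun k => by have := mul_pos (h0 k) hα; simp only [he]; linarith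
  have he2 : ∀ k, e k ≤ 1 := fun k => by simp only [he]; nlinarith [h1 k, h0 k]
  have hint := ((memLp_kernelG hα hα2 h0 h1 fun k => hε.trans_le (hu k)).integrable_abs_rpow
    hα).integrableOn (s := sideBox N l ε p (u l))
  have hvol : volume (sideBox N l ε p (u l)) =
      ENNReal.ofReal (∏ k : Fin N, if k = l then D / 2 else ε / 2) := by
    rw [sideBox, volume_pi_pi, ENNReal.ofReal_prod_of_nonneg]
    · refine Finset.prod_congr rfl fun k _ => ?_
      split_ifs
      · rw [Real.volume_Ioo]; congr 1; rw [hD]; ring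
      · rw [Real.volume_Ioo, sub_zero]
    · intro k _; split_ifs <;> positivity
  have hlow : ∀ w ∈ sideBox N l ε p (u l),
      (∏ k : Fin N, if k = l then D ^ e l / 2 else c₀) ≤ |kernelG N α h u w| ^ α := by
    intro w hw
    rw [kernelG, Finset.abs_prod, ← Real.finsetProd_rpow _ _ fun i _ => abs_nonneg _]
    refine Finset.prod_le_prod (fun k _ => by split_ifs <;> positivity) fun k _ => ?_
    have hval : 0 < w k → w k < u k →
        |ppow (u k - w k) (h k u - 1 / α) - ppow (-w k) (h k u - 1 / α)| ^ α
          = (u k - w k) ^ e k := fun ha hb => by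
      have hb' : 0 < u k - w k := sub_pos.2 hb
      simp only [ppow, hb', if_true, Left.neg_pos_iff, not_lt.2 ha.le, if_false, sub_zero]
      rw [abs_of_pos (by positivity), ← Real.rpow_mul hb'.le]
      congr 1
      simp only [he]; field_simp
    split_ifs with hk
    · subst hk
      obtain ⟨ha, hb⟩ := mem_Ioo_of_mem_sideBox hw
      rw [hval (hp.trans_lt ha) (by linarith)]
      exact half_rpow_le hDpos (by linarith) (by linarith) (he2 k)
    · have hwk := hw k (Set.mem_univ k)
      simp only [hk, if_false] at hwk
      have := hu k
      rw [hval hwk.1 (by linarith [hwk.2])]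
      exact le_rpow_of_mem_Icc hε (by linarith [hwk.2]) (by linarith [hwk.1, huT k])
        (he1 k) (he2 k)
  refine le_trans (le_of_eq ?_) (setIntegral_ge_of_const_le_real (measurableSet_sideBox _ _ _ _ _)
    (by rw [hvol]; exact ENNReal.ofReal_ne_top) hlow hint)
  rw [Measure.real, hvol, ENNReal.toReal_ofReal
    (Finset.prod_nonneg fun k _ => by split_ifs <;> positivity), prod_ite_eq_const,
    prod_ite_eq_const, boxConst, mul_pow,
    show h l u * α = e l + 1 by simp [he], Real.rpow_add_one hDpos.ne']
  ring

theorem boxConst_pos (N : ℕ) {ε T : ℝ} (hε : 0 < ε) (hT : 0 < T) : 0 < boxConst N ε T := by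
  unfold boxConst; positivity

/-- The integral of the characteristic function over the coefficients `x`. -/
noncomputable def charInt (N : ℕ) (α : ℝ) (h : Fin N → (Fin N → ℝ) → ℝ) {n : ℕ}
    (U : Fin n → Fin N → ℝ) : ℝ≥0∞ :=
  ∫⁻ x : Fin n → ℝ, ENNReal.ofReal (Real.exp (-(∫ w : Fin N → ℝ,
    |∑ j, x j * kernelG N α h (U j) w| ^ α)))

theorem charInt_comp_perm {N : ℕ} {α : ℝ} {h : Fin N → (Fin N → ℝ) → ℝ} {n : ℕ}
    (U : Fin n → Fin N → ℝ) (π : Equiv.Perm (Fin n)) :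
    charInt N α h (fun j => U (π j)) = charInt N α h U := by
  have hmp := volume_measurePreserving_piCongrLeft (fun _ : Fin n => ℝ) π
  unfold charInt
  refine Eq.trans (lintegral_congr fun x => ?_)
    (hmp.lintegral_comp_emb (MeasurableEquiv.measurableEmbedding _) _)
  congr 4
  ext w
  congr 2
  refine Eq.trans ?_ (Equiv.sum_comp π _)
  refine Finset.sum_congr rfl fun j _ => ?_
  congr 1
  exact (Equiv.piCongrLeft_apply_apply (fun _ => ℝ) π x j).symm

/-- The constant in the bound of `charInt` by gaps. -/
noncomputable def gapConst (N k : ℕ) (α ε T : ℝ) : ℝ≥0∞ :=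
  (shiftConst α * ENNReal.ofReal (boxConst N ε T) ^ (-1 / α)) ^ (k + 1) *
    ENNReal.ofReal (min ε 1) ^ (-1 : ℝ)

theorem gapConst_ne_top (N k : ℕ) {α ε T : ℝ} (hα : 0 < α) (hε : 0 < ε) (hT : 0 < T) :
    gapConst N k α ε T ≠ ⊤ := by
  refine ENNReal.mul_ne_top (ENNReal.pow_ne_top (ENNReal.mul_ne_top (shiftConst_ne_top hα) ?_)) ?_
  · rw [ENNReal.ofReal_rpow_of_pos (boxConst_pos N hε hT)]; exact ENNReal.ofReal_ne_top
  · rw [ENNReal.ofReal_rpow_of_pos (by positivity)]; exact ENNReal.ofReal_ne_top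

theorem charInt_le_of_monotone {N k : ℕ} {α ε T s : ℝ} (hα : 0 < α) (hα2 : α ≤ 2) (hε : 0 < ε)
    (hT : 0 < T) {h : Fin N → (Fin N → ℝ) → ℝ} {U : Fin (k + 1) → Fin N → ℝ}
    (h0 : ∀ j l, 0 < h l (U j)) (h1 : ∀ j l, h l (U j) < 1)
    (hU : ∀ j l, ε ≤ U j l) (hUT : ∀ j l, U j l ≤ T) (l : Fin N)
    (hmono : Monotone fun j => U j l) (hgap : ∀ i j, U j l - U i l ≤ 1)
    (hs : ∀ j, h l (U j) ≤ s) :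
    charInt N α h U ≤ gapConst N k α ε T *
      ∏ i : Fin k, ENNReal.ofReal |U i.succ l - U i.castSucc l| ^ (-s) := by
  set p : Fin (k + 1) → ℝ := Fin.cons 0 fun i : Fin k => U i.castSucc l with hp
  have hU0 : ∀ j, 0 < U j l := fun j => hε.trans_le (hU j l)
  have hp0 : ∀ j, 0 ≤ p j := fun j => by
    refine Fin.cases (by simp [hp]) (fun i => ?_) j
    simpa [hp] using (hU0 _).le
  have hpU : ∀ j, p j ≤ U j l := fun j => by
    refine Fin.cases (by simpa [hp] using (hU0 0).le) (fun i => ?_) j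
    simpa [hp] using hmono (Fin.castSucc_le_succ i)
  have hUp : ∀ i j, i < j → U i l ≤ p j := fun i j => by
    refine Fin.cases (fun hij => by simp at hij) (fun j hij => ?_) j
    simpa [hp] using hmono (Fin.le_castSucc_iff.2 hij)
  set A : Fin (k + 1) → Set (Fin N → ℝ) := fun j => sideBox N l ε (p j) (U j l) with hA
  have hdisj' : ∀ i j, i < j → Disjoint (A i) (A j) := fun i j hij =>
    Set.disjoint_left.2 fun w hwi hwj => by
      have h1 := (mem_Ioo_of_mem_sideBox hwi).2
      have h2 := (mem_Ioo_of_mem_sideBox hwj).1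
      linarith [hpU i, hUp i j hij]
  have hdisj : Pairwise (Function.onFun Disjoint A) := fun i j hij => by
    rcases lt_or_gt_of_ne hij with h | h
    · exact hdisj' i j h
    · exact (hdisj' j i h).symm
  have hzero : ∀ i j, i < j → ∀ w ∈ A j, kernelG N α h (U i) w = 0 := fun i j hij w hw => by
    have hw' := (mem_Ioo_of_mem_sideBox hw).1
    refine Finset.prod_eq_zero (Finset.mem_univ l) ?_
    have ha : ¬ 0 < U i l - w l := by linarith [hUp i j hij]
    have hb : ¬ 0 < - w l := by linarith [hp0 j]
    simp [ppow, ha, hb]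
  have hb := boxConst_pos N hε hT
  have hfac : ∀ j, shiftConst α *
      ENNReal.ofReal (∫ w in A j, |kernelG N α h (U j) w| ^ α) ^ (-1 / α)
      ≤ shiftConst α * ENNReal.ofReal (boxConst N ε T) ^ (-1 / α) *
        ENNReal.ofReal (U j l - p j) ^ (-h l (U j)) := fun j => by
    rw [mul_assoc]
    gcongr
    have hle := integral_sideBox_kernelG_ge hα hα2 hε (h0 j) (h1 j) (hU j) (hUT j) l
      (hp0 j) (hpU j)
    have hD : 0 ≤ U j l - p j := sub_nonneg.2 (hpU j)
    calc _ ≤ ENNReal.ofReal (boxConst N ε T * (U j l - p j) ^ (h l (U j) * α)) ^ (-1 / α) := by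
          rw [neg_div, ENNReal.rpow_neg, ENNReal.rpow_neg]
          exact ENNReal.inv_le_inv.2 (ENNReal.rpow_le_rpow (ENNReal.ofReal_le_ofReal hle)
            (by positivity))
      _ = _ := by
          rw [ENNReal.ofReal_mul hb.le, ← ENNReal.ofReal_rpow_of_nonneg hD (mul_pos (h0 j l) hα).le,
            ENNReal.mul_rpow_of_ne_top ENNReal.ofReal_ne_top (ENNReal.rpow_ne_top_of_nonneg
              (mul_pos (h0 j l) hα).le ENNReal.ofReal_ne_top),
            ← ENNReal.rpow_mul]
          congr 2
          field_simp
  calc charInt N α h U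
      ≤ ∏ j, (shiftConst α *
          ENNReal.ofReal (∫ w in A j, |kernelG N α h (U j) w| ^ α) ^ (-1 / α)) :=
        lintegral_exp_neg_integral_sum_le hα hα2 (fun j => kernelG N α h (U j))
          (fun j => measurable_kernelG _ _ _ _)
          (fun j => memLp_kernelG hα hα2 (h0 j) (h1 j) fun k => hε.trans_le (hU j k))
          A (fun j => measurableSet_sideBox _ _ _ _ _) hdisj hzero
    _ ≤ ∏ j, (shiftConst α * ENNReal.ofReal (boxConst N ε T) ^ (-1 / α) *
          ENNReal.ofReal (U j l - p j) ^ (-h l (U j))) :=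
        Finset.prod_le_prod' fun j _ => hfac j
    _ = (shiftConst α * ENNReal.ofReal (boxConst N ε T) ^ (-1 / α)) ^ (k + 1) *
          (ENNReal.ofReal (U 0 l) ^ (-h l (U 0)) *
            ∏ i : Fin k, ENNReal.ofReal (U i.succ l - U i.castSucc l) ^ (-h l (U i.succ))) := by
        rw [Finset.prod_mul_distrib, Fin.prod_univ_succ (fun j =>
          ENNReal.ofReal (U j l - p j) ^ (-h l (U j)))]
        simp [hp]
    _ ≤ _ := by
        rw [gapConst, mul_assoc]
        gcongr with i
        · have hmin : ENNReal.ofReal (min ε 1) ≤ 1 := by simp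
          calc _ ≤ ENNReal.ofReal (min ε 1) ^ (-h l (U 0)) := by
                rw [ENNReal.rpow_neg, ENNReal.rpow_neg]
                exact ENNReal.inv_le_inv.2 (ENNReal.rpow_le_rpow (ENNReal.ofReal_le_ofReal
                  ((min_le_left _ _).trans (hU 0 l))) (h0 0 l).le)
            _ ≤ _ := ENNReal.rpow_le_rpow_of_exponent_ge hmin (by linarith [h1 0 l])
        · have hnn : 0 ≤ U i.succ l - U i.castSucc l :=
            sub_nonneg.2 (hmono (Fin.castSucc_le_succ i))
          rw [abs_of_nonneg hnn]
          exact ENNReal.rpow_le_rpow_of_exponent_ge (by simpa using hgap _ _)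
            (by linarith [hs i.succ])

theorem exists_perm_charInt_le {N k : ℕ} {α ε T s : ℝ} (hα : 0 < α) (hα2 : α ≤ 2) (hε : 0 < ε)
    (hT : 0 < T) {h : Fin N → (Fin N → ℝ) → ℝ} {U : Fin (k + 1) → Fin N → ℝ}
    (h0 : ∀ j l, 0 < h l (U j)) (h1 : ∀ j l, h l (U j) < 1)
    (hU : ∀ j l, ε ≤ U j l) (hUT : ∀ j l, U j l ≤ T) (l : Fin N)
    (hgap : ∀ i j, U j l - U i l ≤ 1) (hs : ∀ j, h l (U j) ≤ s) :
    ∃ π : Equiv.Perm (Fin (k + 1)), charInt N α h U ≤ gapConst N k α ε T *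
      ∏ i : Fin k, ENNReal.ofReal |U (π i.succ) l - U (π i.castSucc) l| ^ (-s) := by
  refine ⟨Tuple.sort fun j => U j l, ?_⟩
  rw [← charInt_comp_perm U (Tuple.sort fun j => U j l)]
  exact charInt_le_of_monotone hα hα2 hε hT (fun j => h0 _) (fun j => h1 _) (fun j => hU _)
    (fun j => hUT _) l (Tuple.monotone_sort fun j => U j l) (fun i j => hgap _ _) fun j => hs _

theorem lintegral_Icc_abs_rpow_le {δ θ : ℝ} (hδ : 0 < δ) (hθ1 : θ < 1) :
    ∫⁻ y in Set.Icc (-δ) δ, ENNReal.ofReal |y| ^ (-θ)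
      ≤ ENNReal.ofReal (2 / (1 - θ) * δ ^ (1 - θ)) := by
  have hpos : ∫⁻ y in Set.Ioc 0 δ, ENNReal.ofReal |y| ^ (-θ)
      = ENNReal.ofReal (δ ^ (1 - θ) / (1 - θ)) := by
    have hi : IntegrableOn (fun y : ℝ => y ^ (-θ)) (Set.Ioc 0 δ) := by
      rw [← intervalIntegrable_iff_integrableOn_Ioc_of_le hδ.le]
      exact intervalIntegral.intervalIntegrable_rpow' (by linarith)
    have hv : ∫ y in Set.Ioc 0 δ, y ^ (-θ) = δ ^ (1 - θ) / (1 - θ) := by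
      rw [← intervalIntegral.integral_of_le hδ.le, integral_rpow (Or.inl (by linarith)),
        Real.zero_rpow (by linarith), sub_zero, neg_add_eq_sub]
    rw [← hv, ofReal_integral_eq_lintegral_ofReal hi]
    · refine setLIntegral_congr_fun measurableSet_Ioc fun y hy => ?_
      rw [abs_of_pos hy.1, ENNReal.ofReal_rpow_of_pos hy.1]
    · exact (ae_restrict_iff' measurableSet_Ioc).2 (ae_of_all _ fun y hy =>
        Real.rpow_nonneg hy.1.le _)
  have hneg : ∫⁻ y in Set.Ico (-δ) 0, ENNReal.ofReal |y| ^ (-θ)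
      = ∫⁻ y in Set.Ioc 0 δ, ENNReal.ofReal |y| ^ (-θ) := by
    rw [← (Measure.measurePreserving_neg (volume : Measure ℝ)).setLIntegral_comp_preimage
      measurableSet_Ioc (by fun_prop)]
    simp
  have hsub : Set.Icc (-δ) δ ⊆ (Set.Ico (-δ) 0 ∪ {0}) ∪ Set.Ioc 0 δ := fun y hy => by
    rcases lt_trichotomy y 0 with h | h | h
    · exact Or.inl (Or.inl ⟨hy.1, h⟩)
    · exact Or.inl (Or.inr h)
    · exact Or.inr ⟨h, hy.2⟩
  calc _ ≤ _ := lintegral_mono_set hsub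
    _ ≤ _ := lintegral_union_le _ _ _
    _ ≤ _ := add_le_add_left (lintegral_union_le _ _ _) _
    _ = _ := by
      rw [hneg, hpos, Measure.restrict_singleton]
      simp only [measure_singleton, zero_smul, lintegral_zero_measure, add_zero]
      have : 0 ≤ δ ^ (1 - θ) / (1 - θ) := div_nonneg (by positivity) (by linarith)
      rw [← ENNReal.ofReal_add this this]
      congr 1; ring

theorem lintegral_Icc_abs_sub_rpow_le {a δ θ c : ℝ} (hδ : 0 < δ) (hθ1 : θ < 1)
    (hc : c ∈ Set.Icc a (a + δ)) :
    ∫⁻ t in Set.Icc a (a + δ), ENNReal.ofReal |c - t| ^ (-θ)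
      ≤ ENNReal.ofReal (2 / (1 - θ) * δ ^ (1 - θ)) := by
  refine le_trans ?_ (lintegral_Icc_abs_rpow_le hδ hθ1)
  have hpre := (Measure.measurePreserving_sub_left
    (volume : Measure ℝ) c).setLIntegral_comp_preimage
    (s := Set.Icc (-δ) δ) measurableSet_Icc (f := fun y => ENNReal.ofReal |y| ^ (-θ)) (by fun_prop)
  rw [← hpre]
  refine lintegral_mono_set ?_
  intro t ht
  exact ⟨by linarith [ht.2, hc.1], by linarith [ht.1, hc.2]⟩

theorem setLIntegral_prod_gap_le {k : ℕ} {a δ θ : ℝ} (hδ : 0 < δ) (hθ1 : θ < 1) :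
    ∫⁻ t in Set.univ.pi fun _ : Fin (k + 1) => Set.Icc a (a + δ),
        ∏ i : Fin k, ENNReal.ofReal |t i.succ - t i.castSucc| ^ (-θ)
      ≤ ENNReal.ofReal (2 / (1 - θ) * δ ^ (1 - θ)) ^ k * ENNReal.ofReal δ := by
  set J := Set.Icc a (a + δ) with hJ
  have hJm : MeasurableSet J := measurableSet_Icc
  set φ : ℝ → ℝ≥0∞ := J.indicator 1 with hφ
  have hφm : Measurable φ := measurable_one.indicator hJm
  set f : Fin (k + 1) → (Fin (k + 1) → ℝ) → ℝ≥0∞ :=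
    Fin.snoc (α := fun _ => (Fin (k + 1) → ℝ) → ℝ≥0∞)
      (fun i t => φ (t i.succ) * (φ (t i.castSucc) *
        ENNReal.ofReal |t i.succ - t i.castSucc| ^ (-θ)))
      (fun t => φ (t (Fin.last k))) with hf
  set C : Fin (k + 1) → ℝ≥0∞ := Fin.snoc (α := fun _ => ℝ≥0∞)
    (fun _ => ENNReal.ofReal (2 / (1 - θ) * δ ^ (1 - θ))) (ENNReal.ofReal δ) with hC
  have hle : ∀ t : Fin (k + 1) → ℝ, (Set.univ.pi fun _ : Fin (k + 1) => J).indicator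
      (fun t => ∏ i : Fin k, ENNReal.ofReal |t i.succ - t i.castSucc| ^ (-θ)) t ≤ ∏ j, f j t := by
    intro t
    by_cases ht : t ∈ Set.univ.pi fun _ : Fin (k + 1) => J
    swap
    · rw [Set.indicator_of_notMem ht]; exact zero_le
    rw [Set.indicator_of_mem ht]
    have h1 : ∀ j, φ (t j) = 1 := fun j => by simp [hφ, ht j (Set.mem_univ j)]
    rw [Fin.prod_univ_castSucc]
    refine le_of_eq ?_
    simp [hf, h1]
  rw [← lintegral_indicator (MeasurableSet.univ_pi fun _ => hJm)]
  refine (lintegral_mono hle).trans ((lintegral_prod_le_of_triangular (k + 1) f C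
    (fun j => ?_) (fun j x y => ?_) (fun j x => ?_)).trans ?_)
  · refine Fin.lastCases ?_ (fun i => ?_) j
    · simp only [hf, Fin.snoc_last]; fun_prop
    · simp only [hf, Fin.snoc_castSucc]; fun_prop
  · induction j using Fin.lastCases with
    | last =>
      intro hxy
      simp only [hf, Fin.snoc_last, hxy (Fin.last k) (le_refl (Fin.last k))]
    | cast i =>
      intro hxy
      simp only [hf, Fin.snoc_castSucc, hxy i.castSucc (le_refl i.castSucc),
        hxy i.succ (Fin.castSucc_le_succ i)]
  · refine Fin.lastCases ?_ (fun i => ?_) j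
    · simp only [hf, hC, Fin.snoc_last, Function.update_self]
      rw [hφ, lintegral_indicator_one hJm, hJ, Real.volume_Icc]
      simp
    · simp only [hf, hC, Fin.snoc_castSucc, Function.update_self,
        Function.update_of_ne (Fin.castSucc_lt_succ (i := i)).ne']
      by_cases hx : x i.succ ∈ J
      · simp only [hφ, Set.indicator_of_mem hx, Pi.one_apply, one_mul]
        refine le_of_eq_of_le ?_ (lintegral_Icc_abs_sub_rpow_le hδ hθ1 hx)
        rw [← lintegral_indicator hJm]
        refine lintegral_congr fun t => ?_
        by_cases ht : t ∈ J <;> simp [ht]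
      · simp [hφ, hx]
  · rw [Fin.prod_univ_castSucc]
    refine le_of_eq ?_
    simp [hC]

theorem setLIntegral_prod_gap_perm_le {k : ℕ} {a δ θ : ℝ} (hδ : 0 < δ) (hθ1 : θ < 1)
    (π : Equiv.Perm (Fin (k + 1))) :
    ∫⁻ t in Set.univ.pi fun _ : Fin (k + 1) => Set.Icc a (a + δ),
        ∏ i : Fin k, ENNReal.ofReal |t (π i.succ) - t (π i.castSucc)| ^ (-θ)
      ≤ ENNReal.ofReal (2 / (1 - θ) * δ ^ (1 - θ)) ^ k * ENNReal.ofReal δ := by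
  have hmp := volume_measurePreserving_piCongrLeft (fun _ : Fin (k + 1) => ℝ) π
  have hπ : ∀ (x : Fin (k + 1) → ℝ) j, MeasurableEquiv.piCongrLeft (fun _ => ℝ) π x (π j) = x j :=
    fun x j => Equiv.piCongrLeft_apply_apply (fun _ => ℝ) π x j
  rw [← hmp.setLIntegral_comp_preimage_emb (MeasurableEquiv.measurableEmbedding _)]
  simp_rw [hπ]
  refine le_trans (lintegral_mono_set ?_) (setLIntegral_prod_gap_le (a := a) hδ hθ1)
  intro x hx j _
  rw [← hπ x j]
  exact hx (π j) (Set.mem_univ _)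

theorem ENNReal.prod_rpow_eq_rpow_sum {ι : Type*} (s : Finset ι) (x : ℝ≥0∞) (p : ι → ℝ)
    (hp : ∀ i, 0 ≤ p i) : ∏ i ∈ s, x ^ p i = x ^ ∑ i ∈ s, p i := by
  classical
  induction s using Finset.induction_on with
  | empty => simp
  | insert i s hi ih =>
    rw [prod_insert hi, sum_insert hi, ih,
      ENNReal.rpow_add_of_nonneg _ _ (hp i) (sum_nonneg fun j _ => hp j)]

/-- The constant in the moment bound, for exponents `p l * s l ≤ 1 - κ`. -/
noncomputable def momentConst (N d k : ℕ) (α ε T κ : ℝ) : ℝ≥0∞ :=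
  ENNReal.ofReal ((2 * Real.pi) ^ (-(((k + 1 : ℕ) : ℝ) * d))) *
    (gapConst N k α ε T ^ d *
      ((Nat.factorial (k + 1) : ℝ≥0∞) * ENNReal.ofReal (2 / κ) ^ k) ^ N)

theorem momentConst_ne_top (N d k : ℕ) {α ε T κ : ℝ} (hα : 0 < α) (hε : 0 < ε) (hT : 0 < T) :
    momentConst N d k α ε T κ ≠ ⊤ :=
  ENNReal.mul_ne_top ENNReal.ofReal_ne_top (ENNReal.mul_ne_top
    (ENNReal.pow_ne_top (gapConst_ne_top N k hα hε hT))
    (ENNReal.pow_ne_top (ENNReal.mul_ne_top (ENNReal.natCast_ne_top _)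
      (ENNReal.pow_ne_top ENNReal.ofReal_ne_top))))

theorem Mn_le_of_exponents {N d k : ℕ} {α ε T δ κ : ℝ} {h : Fin N → (Fin N → ℝ) → ℝ}
    {a : Fin N → ℝ} {p s : Fin N → ℝ} (hα : 0 < α) (hα2 : α ≤ 2) (hε : 0 < ε) (hT : 0 < T)
    (h0 : ∀ l u, 0 < h l u) (h1 : ∀ l u, h l u < 1) (hδ : 0 < δ) (hδ1 : δ ≤ 1)
    (hsub : Set.Icc a (fun l => a l + δ) ⊆ Set.Icc (fun _ : Fin N => ε) (fun _ => T))
    (hp : ∀ l, 0 ≤ p l) (hpd : ∑ l, p l = d)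
    (hs : ∀ v ∈ Set.Icc a (fun l => a l + δ), ∀ l, h l v ≤ s l)
    (hκ : 0 < κ) (hps : ∀ l, p l * s l ≤ 1 - κ) :
    Mn N d α h (k + 1) (Set.Icc a (fun l => a l + δ)) ≤ momentConst N d k α ε T κ *
      ENNReal.ofReal (δ ^ ∑ l, (k * (1 - p l * s l) + 1)) := by
  set K := gapConst N k α ε T with hK
  set C := Set.Icc a (fun l => a l + δ) with hC
  set J : Fin N → Set (Fin (k + 1) → ℝ) :=
    fun l => Set.univ.pi fun _ : Fin (k + 1) => Set.Icc (a l) (a l + δ) with hJ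
  have hJm : ∀ l, MeasurableSet (J l) := fun l => MeasurableSet.univ_pi fun _ => measurableSet_Icc
  set G : Fin N → Equiv.Perm (Fin (k + 1)) → (Fin (k + 1) → ℝ) → ℝ≥0∞ := fun l π t =>
    ∏ i : Fin k, ENNReal.ofReal |t (π i.succ) - t (π i.castSucc)| ^ (-(p l * s l)) with hG
  have hGm : ∀ l π, Measurable (G l π) := fun l π => by simp only [hG]; fun_prop
  set Φ : Fin N → (Fin (k + 1) → ℝ) → ℝ≥0∞ := fun l =>
    (J l).indicator fun t => K ^ p l * ∑ π, G l π t with hΦ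
  have hΦm : ∀ l, Measurable (Φ l) := fun l =>
    Measurable.indicator (measurable_const.mul (Finset.measurable_sum _ fun π _ => hGm l π)) (hJm l)
  have hmemC : ∀ {v : Fin N → ℝ}, v ∈ C → ∀ l, v l ∈ Set.Icc (a l) (a l + δ) :=
    fun hv l => ⟨hv.1 l, hv.2 l⟩
  have hpt : ∀ U : Fin (k + 1) → Fin N → ℝ, (∀ j, U j ∈ C) →
      charInt N α h U ^ d ≤ ∏ l, Φ l (fun j => U j l) := by
    intro U hU
    rw [← ENNReal.rpow_natCast, ← hpd, ← ENNReal.prod_rpow_eq_rpow_sum _ _ _ hp]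
    refine Finset.prod_le_prod' fun l _ => ?_
    have hmem : (fun j => U j l) ∈ J l := fun j _ => hmemC (hU j) l
    obtain ⟨π, hπ⟩ := exists_perm_charInt_le (s := s l) hα hα2 hε hT (fun j l => h0 l (U j))
      (fun j l => h1 l (U j)) (fun j l => (hsub (hU j)).1 l) (fun j l => (hsub (hU j)).2 l) l
      (fun i j => by
        have h2 := hmemC (hU j) l
        have h3 := hmemC (hU i) l
        linarith [h2.2, h3.1]) (fun j => hs _ (hU j) l)
    simp only [hΦ, Set.indicator_of_mem hmem]
    calc charInt N α h U ^ p l ≤ _ := ENNReal.rpow_le_rpow hπ (hp l)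
      _ = K ^ p l * G l π (fun j => U j l) := by
        rw [ENNReal.mul_rpow_of_nonneg _ _ (hp l), ← ENNReal.prod_rpow_of_nonneg (hp l)]
        congr 1
        refine Finset.prod_congr rfl fun i _ => ?_
        rw [← ENNReal.rpow_mul]
        congr 1; ring
      _ ≤ _ := by
        gcongr
        exact Finset.single_le_sum (f := fun π => G l π fun j => U j l) (fun _ _ => zero_le)
          (Finset.mem_univ π)
  have hcol : ∀ l, ∫⁻ t, Φ l t ≤ K ^ p l *
      (((Nat.factorial (k + 1) : ℝ≥0∞) * ENNReal.ofReal (2 / κ) ^ k) *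
        ENNReal.ofReal (δ ^ (k * (1 - p l * s l) + 1))) := by
    intro l
    have hθ : p l * s l < 1 := by linarith [hps l]
    rw [hΦ, lintegral_indicator (hJm l), lintegral_const_mul _
      (Finset.measurable_sum _ fun π _ => hGm l π), lintegral_finsetSum _ fun π _ => hGm l π]
    gcongr
    refine (Finset.sum_le_sum fun π _ => setLIntegral_prod_gap_perm_le hδ hθ π).trans ?_
    rw [Finset.sum_const, Finset.card_univ, Fintype.card_perm, Fintype.card_fin, nsmul_eq_mul,
      mul_assoc]
    refine mul_le_mul_right ?_ _
    have hle : 2 / (1 - p l * s l) ≤ 2 / κ := by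
      gcongr
      linarith [hps l]
    have hδ' : ENNReal.ofReal (δ ^ (k * (1 - p l * s l) + 1))
        = ENNReal.ofReal (δ ^ (1 - p l * s l)) ^ k * ENNReal.ofReal δ := by
      rw [← ENNReal.ofReal_pow (by positivity), ← ENNReal.ofReal_mul (by positivity),
        ← Real.rpow_natCast, ← Real.rpow_mul hδ.le, Real.rpow_add hδ, Real.rpow_one,
        mul_comm (k : ℝ)]
    rw [hδ', ← mul_assoc, ← mul_pow, ← ENNReal.ofReal_mul (by positivity)]
    gcongr
  have hset : MeasurableSet {U : Fin (k + 1) → Fin N → ℝ | ∀ j, U j ∈ C} := by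
    have : {U : Fin (k + 1) → Fin N → ℝ | ∀ j, U j ∈ C} = Set.univ.pi fun _ => C := by
      ext U; simp
    rw [this]
    exact MeasurableSet.univ_pi fun _ => measurableSet_Icc
  have hmain : ∫⁻ U : Fin (k + 1) → Fin N → ℝ in {U | ∀ j, U j ∈ C}, charInt N α h U ^ d ≤
      K ^ d * (((Nat.factorial (k + 1) : ℝ≥0∞) * ENNReal.ofReal (2 / κ) ^ k) ^ N *
        ENNReal.ofReal (δ ^ ∑ l, (k * (1 - p l * s l) + 1))) := by
    calc _ ≤ ∫⁻ U : Fin (k + 1) → Fin N → ℝ in {U | ∀ j, U j ∈ C}, ∏ l, Φ l (fun j => U j l) :=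
          setLIntegral_mono' hset hpt
      _ ≤ ∫⁻ U : Fin (k + 1) → Fin N → ℝ, ∏ l, Φ l (fun j => U j l) := setLIntegral_le_lintegral _ _
      _ ≤ ∏ l, ∫⁻ t, Φ l t := lintegral_prod_col_le _ _ Φ hΦm
      _ ≤ _ := Finset.prod_le_prod' fun l _ => hcol l
      _ = _ := by
        rw [Finset.prod_mul_distrib, Finset.prod_mul_distrib, Finset.prod_const, Finset.card_univ,
          Fintype.card_fin, ENNReal.prod_rpow_eq_rpow_sum _ _ _ hp, hpd, ENNReal.rpow_natCast,
          ← ENNReal.ofReal_prod_of_nonneg fun l _ => by positivity,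
          Real.rpow_sum_of_pos hδ]
  rw [Mn, momentConst, mul_assoc, mul_assoc]
  gcongr
  exact hmain

theorem exists_weights_betaFn {N d : ℕ} {h : Fin N → (Fin N → ℝ) → ℝ} {v : Fin N → ℝ}
    (σ : Equiv.Perm (Fin N)) (hpos : ∀ l, 0 < h l v) (hsum : (d : ℝ) < ∑ l, 1 / h l v) :
    ∃ q : Fin N → ℝ, (∀ l, 0 ≤ q l) ∧ (∀ l, q l * h l v ≤ 1) ∧ ∑ l, q l = d ∧
      betaFn N d h σ v = N - ∑ l, q l * h l v := by
  set r : Fin N → ℝ := fun l => 1 / h (σ l) v with hr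
  have hrpos : ∀ l, 0 < r l := fun l => one_div_pos.2 (hpos _)
  set S : ℕ → ℝ := fun mm => ∑ l ∈ univ.filter (fun l : Fin N => (l : ℕ) < mm), r l with hS
  set A : Set ℕ := {mm | (d : ℝ) < S mm} with hA
  have hγ : gammaIdx N d h σ v = sInf A := rfl
  have hNA : N ∈ A := by
    have : S N = ∑ l, 1 / h l v := by
      rw [hS, ← Equiv.sum_comp σ (fun l => 1 / h l v)]
      simp [hr]
    exact hsum.trans_eq this.symm
  have hγA : sInf A ∈ A := Nat.sInf_mem ⟨N, hNA⟩
  obtain ⟨g, hg⟩ : ∃ g, sInf A = g + 1 := by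
    refine Nat.exists_eq_succ_of_ne_zero fun h0 => ?_
    rw [h0] at hγA
    have : (d : ℝ) < 0 := by simpa [hA, hS] using hγA
    exact absurd this (not_lt.2 (Nat.cast_nonneg d))
  have hgN : g < N := by
    have := Nat.sInf_le hNA
    omega
  have hSg : S g ≤ d := not_lt.1 fun hlt => by
    have : sInf A ≤ g := Nat.sInf_le (show g ∈ A from hlt)
    omega
  set i : Fin N := ⟨g, hgN⟩ with hi
  have hfilter : univ.filter (fun l : Fin N => (l : ℕ) < g + 1)
      = insert i (univ.filter (fun l : Fin N => (l : ℕ) < g)) := by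
    ext l
    simp only [mem_filter, mem_univ, true_and, mem_insert, Fin.ext_iff, hi]
    omega
  have hiS : i ∉ univ.filter (fun l : Fin N => (l : ℕ) < g) := by simp [hi]
  have hSsucc : S (g + 1) = r i + S g := by
    simp only [hS]
    rw [hfilter, sum_insert hiS]
  have hlt : (d : ℝ) < r i + S g := by
    rw [← hSsucc, ← hg]
    exact hγA
  set q : Fin N → ℝ := fun l =>
    (if (l : ℕ) < g then r l else 0) + (if l = i then d - S g else 0) with hq
  have hri : r i * h (σ i) v = 1 := one_div_mul_cancel (hpos _).ne'
  have hsumq : ∑ l, q l = d := by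
    simp only [hq, sum_add_distrib, sum_ite_eq', mem_univ, if_true, ← sum_filter]
    simp [hS]
  have hsumqh : ∑ l, q l * h (σ l) v = g + (d - S g) * h (σ i) v := by
    simp only [hq, add_mul, sum_add_distrib, ite_mul, zero_mul, sum_ite_eq', mem_univ, if_true,
      ← sum_filter]
    congr 1
    rw [sum_congr rfl fun l _ => one_div_mul_cancel (hpos (σ l)).ne', sum_const, nsmul_eq_mul,
      mul_one, Fin.card_filter_val_lt, min_eq_right hgN.le]
  have hq0 : ∀ l, 0 ≤ q l := fun l => by
    refine add_nonneg ?_ ?_ <;> split_ifs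
    exacts [(hrpos l).le, le_rfl, sub_nonneg.2 hSg, le_rfl]
  have hq1 : ∀ l, q l ≤ r l := fun l => by
    have hl := (hrpos l).le
    simp only [hq]
    by_cases hli : l = i
    · subst hli
      simp only [hi, lt_irrefl, if_false, if_true, zero_add]
      linarith
    · simp only [hli, if_false, add_zero]
      split_ifs
      exacts [le_rfl, hl]
  refine ⟨fun l => q (σ.symm l), fun l => hq0 _, fun l => ?_, ?_, ?_⟩
  · refine (mul_le_mul_of_nonneg_right (hq1 _) (hpos l).le).trans_eq ?_
    simp only [hr, Equiv.apply_symm_apply]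
    exact one_div_mul_cancel (hpos l).ne'
  · rw [Equiv.sum_comp σ.symm q, hsumq]
  · have hsum' : ∑ l, q (σ.symm l) * h l v = g + (d - S g) * h (σ i) v := by
      rw [← hsumqh, ← Equiv.sum_comp σ]
      simp
    have hγ' : gammaIdx N d h σ v - 1 = g := by rw [hγ, hg]; rfl
    have hcond : gammaIdx N d h σ v - 1 < N := by rw [hγ']; exact hgN
    have hidx : (⟨gammaIdx N d h σ v - 1, hcond⟩ : Fin N) = i := Fin.ext hγ'
    have hSγ : ∑ l ∈ univ.filter (fun l : Fin N => (l : ℕ) < gammaIdx N d h σ v), 1 / h (σ l) v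
        = r i + S g := by
      rw [hγ, hg]; exact hSsucc
    rw [hsum', betaFn, dif_pos hcond, hidx, hSγ, hγ, hg]
    push_cast
    linear_combination hri

theorem exists_exponents {N d k : ℕ} {f q : Fin N → ℝ} {μ τ ρ η : ℝ} (hμ : 0 < μ)
    (hd : 1 ≤ d) (hf : ∀ l, μ ≤ f l) (hq : ∀ l, 0 ≤ q l) (hqf : ∀ l, q l * f l ≤ 1)
    (hqd : ∑ l, q l = d) (hτ : 0 ≤ τ) (hτ1 : τ ≤ 1) (hη : 0 ≤ η) (hρ0 : 0 ≤ ρ)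
    (hρ : ρ ≤ 1) (hR : (d : ℝ) ≤ ρ * ∑ l, 1 / f l) (hηd : η * d = τ * (1 - ρ) / 2)
    (hN : 1 ≤ N) (hτμ : (k + 1) * (τ * N) = μ / 4) :
    ∃ p : Fin N → ℝ, (∀ l, 0 ≤ p l) ∧ ∑ l, p l = d ∧
      (∀ l, p l * (f l + η) ≤ 1 - τ * (1 - ρ) / 2) ∧
      (k + 1) * (N - ∑ l, q l * f l) + μ / 2 ≤ ∑ l, (k * (1 - p l * (f l + η)) + 1) := by
  have hf0 : ∀ l, 0 < f l := fun l => hμ.trans_le (hf l)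
  set R := ∑ l, 1 / f l with hRdef
  have hd1 : (1 : ℝ) ≤ d := by exact_mod_cast hd
  have hN1 : (1 : ℝ) ≤ N := by exact_mod_cast hN
  have hRpos : 0 < R := by
    refine (sum_nonneg fun l _ => (one_div_pos.2 (hf0 l)).le).lt_of_ne fun h0 => ?_
    rw [← hRdef] at h0
    rw [← h0, mul_zero] at hR
    linarith
  set θ := d / R with hθ
  have hθ0 : 0 ≤ θ := by positivity
  have hθρ : θ ≤ ρ := (div_le_iff₀ hRpos).2 hR
  set p : Fin N → ℝ := fun l => (1 - τ) * q l + τ * θ * (1 / f l) with hp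
  have hp0 : ∀ l, 0 ≤ p l := fun l => by
    have := hf0 l
    have := hq l
    have : 0 ≤ 1 - τ := by linarith
    positivity
  have hpf : ∀ l, p l * f l = (1 - τ) * (q l * f l) + τ * θ := fun l => by
    have := (hf0 l).ne'
    simp only [hp]
    field_simp
  have hpd : ∑ l, p l = d := by
    simp only [hp, sum_add_distrib, ← mul_sum, hqd, ← hRdef]
    rw [mul_assoc, hθ, div_mul_cancel₀ _ hRpos.ne']
    ring
  have hpled : ∀ l, p l ≤ d := fun l =>
    hpd ▸ single_le_sum (f := p) (fun j _ => hp0 j) (mem_univ l)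
  refine ⟨p, hp0, hpd, fun l => ?_, ?_⟩
  · rw [mul_add, hpf]
    have h1 := mul_le_mul_of_nonneg_left (hqf l) (sub_nonneg.2 hτ1)
    have h2 := mul_le_mul_of_nonneg_left hθρ hτ
    have h3 := mul_le_mul_of_nonneg_right (hpled l) hη
    linarith
  · set Q := ∑ l, q l * f l with hQ
    have hQμ : μ ≤ Q := by
      calc μ ≤ d * μ := by nlinarith
        _ = ∑ l, q l * μ := by rw [← sum_mul, hqd]
        _ ≤ Q := sum_le_sum fun l _ => mul_le_mul_of_nonneg_left (hf l) (hq l)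
    have hps : ∑ l, p l * (f l + η) = (1 - τ) * Q + N * (τ * θ) + d * η := by
      simp only [mul_add, hpf, sum_add_distrib, ← mul_sum, ← sum_mul, hpd, ← hQ, sum_const,
        card_univ, Fintype.card_fin, nsmul_eq_mul]
      ring
    have hle : ∑ l, p l * (f l + η) ≤ Q + 2 * (τ * N) := by
      rw [hps]
      have h1 : 0 ≤ τ * Q := mul_nonneg hτ (hμ.le.trans hQμ)
      have h2 : N * (τ * θ) ≤ N * (τ * 1) := by gcongr; linarith
      have h3 : τ * (1 - ρ) ≤ τ * N := by gcongr; linarith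
      have h4 : 0 ≤ τ * N := by positivity
      linarith
    have hsum : ∑ l, (k * (1 - p l * (f l + η)) + 1)
        = (k + 1) * N - k * ∑ l, p l * (f l + η) := by
      simp only [sum_add_distrib, ← mul_sum, sum_sub_distrib, sum_const, card_univ,
        Fintype.card_fin, nsmul_eq_mul]
      ring
    rw [hsum]
    have hk := mul_le_mul_of_nonneg_left hle (Nat.cast_nonneg (α := ℝ) k)
    have h4 : 0 ≤ τ * N := by positivity
    nlinarith

theorem exists_le_of_iSup_mem {ι X : Type*} [Nonempty ι] {C : Set X} (hC : C.Nonempty)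
    {F : ι → X → ℝ} (hF : ∀ i, ∀ x ∈ C, 0 ≤ F i x) {e : ℝ} (he : 0 < e) :
    ∃ i, ∃ x ∈ C, (⨆ i, ⨆ x ∈ C, F i x) - e ≤ F i x := by
  obtain ⟨x₀, hx₀⟩ := hC
  have : Nonempty X := ⟨x₀⟩
  obtain ⟨i, hi⟩ := exists_lt_of_lt_ciSup (sub_lt_self (⨆ i, ⨆ x ∈ C, F i x) he)
  obtain ⟨x, hx⟩ := exists_lt_of_lt_ciSup hi
  by_cases hxC : x ∈ C
  · rw [ciSup_pos hxC] at hx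
    exact ⟨i, x, hxC, hx.le⟩
  · rw [ciSup_neg hxC, Real.sSup_empty] at hx
    exact ⟨i, x₀, hx₀, hx.le.trans (hF i x₀ hx₀)⟩

theorem exists_uniform_modulus {N : ℕ} {h : Fin N → (Fin N → ℝ) → ℝ} {m M : Fin N → ℝ}
    (hm : ∀ l, 0 < m l) {I : Set (Fin N → ℝ)} {c : ℝ} (hc : 0 < c)
    (hh : ∀ u ∈ I, ∀ v ∈ I, ∀ l,
      |h l u - h l v| ≤ c * ∑ l', min (|u l' - v l'| ^ m l') (|u l' - v l'| ^ M l'))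
    {η : ℝ} (hη : 0 < η) :
    ∃ δ₀ : ℝ, 0 < δ₀ ∧ δ₀ ≤ 1 ∧ ∀ u ∈ I, ∀ v ∈ I, (∀ l, |u l - v l| ≤ δ₀) →
      ∀ l, |h l u - h l v| < η := by
  have hcont : ContinuousAt (fun δ : ℝ => c * ∑ l, δ ^ m l) 0 := by
    refine continuousAt_const.mul (tendsto_finsetSum _ fun l _ => ?_)
    exact Real.continuousAt_rpow_const _ _ (Or.inr (hm l).le)
  have hzero : c * ∑ l, (0 : ℝ) ^ m l = 0 := by
    simp [Real.zero_rpow (hm _).ne']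
  have hev : ∀ᶠ δ : ℝ in nhds 0, c * ∑ l, δ ^ m l < η :=
    hcont.eventually_lt_const (hzero.trans_lt hη)
  have hev' : ∀ᶠ δ : ℝ in nhdsWithin 0 (Set.Ioi 0), c * ∑ l, δ ^ m l < η ∧ δ ∈ Set.Ioc (0 : ℝ) 1 :=
    (hev.filter_mono nhdsWithin_le_nhds).and (Ioc_mem_nhdsGT one_pos)
  obtain ⟨δ₀, hδ, h0, h1⟩ := hev'.exists
  refine ⟨δ₀, h0, h1, fun u hu v hv huv l => (hh u hu v hv l).trans_lt (lt_of_le_of_lt ?_ hδ)⟩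
  gcongr with l' _
  exact (min_le_left _ _).trans (Real.rpow_le_rpow (abs_nonneg _) (huv l') (hm l').le)

theorem exists_ratio_lt_one {N d : ℕ} {h : Fin N → (Fin N → ℝ) → ℝ} {I : Set (Fin N → ℝ)}
    (hI : IsCompact I) (hne : I.Nonempty) (hpos : ∀ l u, 0 < h l u)
    (hmod : ∀ η > 0, ∃ δ₀ : ℝ, 0 < δ₀ ∧ δ₀ ≤ 1 ∧ ∀ u ∈ I, ∀ v ∈ I, (∀ l, |u l - v l| ≤ δ₀) →
      ∀ l, |h l u - h l v| < η)
    (hsum : ∀ v ∈ I, (d : ℝ) < ∑ l, 1 / h l v) :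
    ∃ ρ : ℝ, 0 ≤ ρ ∧ ρ < 1 ∧ ∀ v ∈ I, (d : ℝ) ≤ ρ * ∑ l, 1 / h l v := by
  have hcont : ∀ l, ContinuousOn (h l) I := fun l => by
    refine Metric.continuousOn_iff.2 fun v hv η hη => ?_
    obtain ⟨δ₀, h0, _, hδ⟩ := hmod η hη
    refine ⟨δ₀, h0, fun u hu huv => hδ u hu v hv (fun l' => ?_) l⟩
    exact (dist_le_pi_dist u v l').trans huv.le
  obtain ⟨v₀, hv₀, hmin⟩ := hI.exists_isMinOn hne (f := fun v => ∑ l, 1 / h l v)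
    (continuousOn_finsetSum _ fun l _ => continuousOn_const.div (hcont l) fun v _ => (hpos l v).ne')
  set S := ∑ l, 1 / h l v₀ with hS
  have hSd : (d : ℝ) < S := hsum v₀ hv₀
  have hS0 : 0 < S := (Nat.cast_nonneg d).trans_lt hSd
  refine ⟨d / S, by positivity, (div_lt_one hS0).2 hSd, fun v hv => ?_⟩
  calc (d : ℝ) = d / S * S := (div_mul_cancel₀ _ hS0.ne').symm
    _ ≤ _ := mul_le_mul_of_nonneg_left (hmin hv) (by positivity)

/-- Lemma 3.4 (analytic content): moment bound `M_n(I_{a,δ}) ≤ c(n) δ^{n β̄}`. -/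
theorem moment_bound_local_time (N : ℕ) (hN : 1 ≤ N) (d : ℕ) (hd : 1 ≤ d)
    (α : ℝ) (hα0 : 0 < α) (hα2 : α ≤ 2)
    (h : Fin N → (Fin N → ℝ) → ℝ) (m M : Fin N → ℝ)
    (hm : ∀ l, 0 < m l) (hmM : ∀ l, m l ≤ M l) (hM1 : ∀ l, M l < 1)
    (hH1 : ∀ l u, m l ≤ h l u ∧ h l u ≤ M l)
    (hH2 : ∀ K : Set (Fin N → ℝ), IsCompact K → ∃ c > 0, ∀ u ∈ K, ∀ v ∈ K, ∀ l,
      |h l u - h l v| ≤ c * ∑ l', min (|u l' - v l'| ^ m l') (|u l' - v l'| ^ M l'))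
    (ε T : ℝ) (hε : 0 < ε) (hεT : ε < T)
    (hC1 : ∀ v ∈ Set.Icc (fun _ : Fin N => ε) (fun _ => T), (d : ℝ) < ∑ l, 1 / h l v) :
    ∀ n : ℕ, 1 ≤ n → ∃ c > (0 : ℝ), ∃ δ₀ : ℝ, 0 < δ₀ ∧ δ₀ ≤ 1 ∧
      ∀ (a : Fin N → ℝ) (δ : ℝ), 0 < δ → δ ≤ δ₀ →
        Set.Icc a (fun l => a l + δ) ⊆ Set.Icc (fun _ : Fin N => ε) (fun _ => T) →
        Mn N d α h n (Set.Icc a (fun l => a l + δ)) ≤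
          ENNReal.ofReal (c * δ ^ ((n : ℝ) *
            ⨆ σ : Equiv.Perm (Fin N), ⨆ v ∈ Set.Icc a (fun l => a l + δ),
              betaFn N d h σ v)) := by
  intro n hn
  obtain ⟨k, rfl⟩ : ∃ k, n = k + 1 := ⟨n - 1, by omega⟩
  set I := Set.Icc (fun _ : Fin N => ε) (fun _ => T) with hI
  have hT : 0 < T := hε.trans hεT
  have hh0 : ∀ l u, 0 < h l u := fun l u => (hm l).trans_le (hH1 l u).1
  have hh1 : ∀ l u, h l u < 1 := fun l u => (hH1 l u).2.trans_lt (hM1 l)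
  have hInc : I.Nonempty := ⟨fun _ => ε, le_refl _, fun _ => hεT.le⟩
  obtain ⟨c₀, hc₀, hc⟩ := hH2 I isCompact_Icc
  have hmod := fun η (hη : (0 : ℝ) < η) => exists_uniform_modulus hm hc₀ hc hη
  obtain ⟨ρ, hρ0, hρ1, hρ⟩ := exists_ratio_lt_one isCompact_Icc hInc hh0 hmod hC1
  have : Nonempty (Fin N) := ⟨⟨0, hN⟩⟩
  obtain ⟨l₀, hl₀⟩ := Finite.exists_min m
  set μ := m l₀ with hμ
  have hμ0 : 0 < μ := hm l₀
  have hμ1 : μ < 1 := (hmM l₀).trans_lt (hM1 l₀)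
  have hN1 : (1 : ℝ) ≤ N := by exact_mod_cast hN
  have hd1 : (1 : ℝ) ≤ d := by exact_mod_cast hd
  have hk1 : (1 : ℝ) ≤ k + 1 := by linarith [Nat.cast_nonneg (α := ℝ) k]
  set τ := μ / (4 * ((k + 1) * N)) with hτ
  have hτ0 : 0 < τ := by positivity
  have hτ1 : τ ≤ 1 := by
    refine (div_le_one (by positivity)).2 ?_
    nlinarith
  have hτμ : (k + 1) * (τ * N) = μ / 4 := by
    rw [hτ]
    field_simp
  have hρ' : 0 < 1 - ρ := sub_pos.2 hρ1
  set η := τ * (1 - ρ) / 2 / d with hη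
  have hη0 : 0 < η := by positivity
  have hηd : η * d = τ * (1 - ρ) / 2 := div_mul_cancel₀ _ (by positivity)
  obtain ⟨δ₀, hδ0, hδ1, hδ⟩ := hmod η hη0
  set κ := τ * (1 - ρ) / 2 with hκ
  have hκ0 : 0 < κ := by positivity
  have hcK := momentConst_ne_top N d k (κ := κ) hα0 hε hT
  refine ⟨(momentConst N d k α ε T κ).toReal + 1, by positivity, δ₀, hδ0, hδ1, ?_⟩
  intro a δ hδpos hδle hsub
  set C := Set.Icc a (fun l => a l + δ) with hC
  have hweights := fun (σ : Equiv.Perm (Fin N)) v (hv : v ∈ C) =>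
    exists_weights_betaFn σ (fun l => hh0 l v) (hC1 v (hsub hv))
  have hβ0 : ∀ (σ : Equiv.Perm (Fin N)), ∀ v ∈ C, 0 ≤ betaFn N d h σ v := fun σ v hv => by
    obtain ⟨q, -, hq1, -, hβ⟩ := hweights σ v hv
    rw [hβ, sub_nonneg]
    simpa using sum_le_sum fun l (_ : l ∈ univ) => hq1 l
  obtain ⟨σ, v, hv, hβ⟩ := exists_le_of_iSup_mem (C := C)
    ⟨a, le_refl _, fun l => le_add_of_nonneg_right hδpos.le⟩ hβ0
    (e := μ / (2 * (k + 1))) (by positivity)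
  set b := ⨆ σ : Equiv.Perm (Fin N), ⨆ v ∈ C, betaFn N d h σ v with hb
  obtain ⟨q, hq0, hq1, hqd, hβq⟩ := hweights σ v hv
  obtain ⟨p, hp0, hpd, hps, hexp⟩ := exists_exponents (k := k) hμ0 hd
    (fun l => (hl₀ l).trans (hH1 l v).1) hq0 hq1 hqd hτ0.le hτ1 hη0.le hρ0 hρ1.le
    (hρ v (hsub hv)) hηd hN hτμ
  have hs : ∀ w ∈ C, ∀ l, h l w ≤ h l v + η := fun w hw l => by
    have := hδ w (hsub hw) v (hsub hv) (fun l' => ?_) l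
    · linarith [le_abs_self (h l w - h l v)]
    · rw [abs_le]
      constructor <;> linarith [hw.1 l', hw.2 l', hv.1 l', hv.2 l']
  have hMn := Mn_le_of_exponents (k := k) hα0 hα2 hε hT hh0 hh1 hδpos (hδle.trans hδ1) hsub hp0 hpd
    hs hκ0 hps
  refine hMn.trans ?_
  have hE : ((k + 1 : ℕ) : ℝ) * b ≤ ∑ l, (k * (1 - p l * (h l v + η)) + 1) := by
    refine le_trans ?_ hexp
    rw [← hβq]
    have h1 : (k + 1) * (μ / (2 * (k + 1))) = μ / 2 := by field_simp
    have h2 := mul_le_mul_of_nonneg_left hβ (zero_le_one.trans hk1)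
    push_cast
    linarith
  rw [ENNReal.ofReal_mul (by positivity)]
  refine mul_le_mul' ?_ (ENNReal.ofReal_le_ofReal
    (Real.rpow_le_rpow_of_exponent_ge hδpos (hδle.trans hδ1) hE))
  exact (ENNReal.le_ofReal_iff_toReal_le hcK (by positivity)).2 (by linarith)
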